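/- Let n ≥ 2 be an integer. The infimum, over all functions u : ℝⁿ → ℝ of class C² with compact support contained in ℝⁿ \ {0} and with ∫_{ℝⁿ} |x|^{2-n} |∇u(x)|² dx ≠ 0, of the quotient (∫_{ℝⁿ} |x|^{4-n} |Δu(x)|² dx) / (∫_{ℝⁿ} |x|^{2-n} |∇u(x)|² dx) equals min{(n-2)², n-1}. -/

import Mathlib

open MeasureTheory

noncomputable def lap {n : ℕ} (u : EuclideanSpace ℝ (Fin n) → ℝ)
    (x : EuclideanSpace ℝ (Fin n)) : ℝ :=
  ∑ i : Fin n, iteratedFDeriv ℝ 2 u x ![EuclideanSpace.single i 1, EuclideanSpace.single i 1]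

/-- The `i`-th partial derivative. -/
noncomputable def pderiv {n : ℕ} (i : Fin n) (f : EuclideanSpace ℝ (Fin n) → ℝ)
    (x : EuclideanSpace ℝ (Fin n)) : ℝ :=
  fderiv ℝ f x (EuclideanSpace.single i 1)

/-- `f` is of class `C^k` with compact support in the complement of the origin. -/
structure IsTest {n : ℕ} (k : WithTop ℕ∞) (f : EuclideanSpace ℝ (Fin n) → ℝ) : Prop where
  contDiff : ContDiff ℝ k f
  compact : HasCompactSupport f
  zero_notMem : (0 : EuclideanSpace ℝ (Fin n)) ∉ tsupport f

/-- `f` is integrable with vanishing integral. -/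
def IsNull {n : ℕ} (f : EuclideanSpace ℝ (Fin n) → ℝ) : Prop :=
  Integrable f ∧ ∫ x, f x = 0

section Null

variable {n : ℕ} {f g : EuclideanSpace ℝ (Fin n) → ℝ}

theorem IsNull.add (hf : IsNull f) (hg : IsNull g) : IsNull fun x => f x + g x :=
  ⟨hf.1.add hg.1, by rw [integral_add hf.1 hg.1, hf.2, hg.2, add_zero]⟩

theorem IsNull.const_mul (hf : IsNull f) (c : ℝ) : IsNull fun x => c * f x :=
  ⟨hf.1.const_mul c, by rw [integral_const_mul, hf.2, mul_zero]⟩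

theorem IsNull.sub (hf : IsNull f) (hg : IsNull g) : IsNull fun x => f x - g x :=
  ⟨hf.1.sub hg.1, by rw [integral_sub hf.1 hg.1, hf.2, hg.2, sub_zero]⟩

theorem IsNull.sum {ι : Type*} {s : Finset ι} {F : ι → EuclideanSpace ℝ (Fin n) → ℝ}
    (hF : ∀ i ∈ s, IsNull (F i)) : IsNull fun x => ∑ i ∈ s, F i x :=
  ⟨integrable_finsetSum s fun i hi => (hF i hi).1, by
    rw [integral_finsetSum s fun i hi => (hF i hi).1]
    exact Finset.sum_eq_zero fun i hi => (hF i hi).2⟩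

theorem ae_ne_zero [NeZero n] : ∀ᵐ x : EuclideanSpace ℝ (Fin n), x ≠ 0 := by
  have : Nontrivial (EuclideanSpace ℝ (Fin n)) := by
    refine ⟨EuclideanSpace.single 0 1, 0, ?_⟩
    simp
  simp [ae_iff]

theorem IsNull.congr [NeZero n] (hf : IsNull f) (h : ∀ x ≠ 0, f x = g x) : IsNull g := by
  have h' : f =ᵐ[volume] g := by filter_upwards [ae_ne_zero] with x hx using h x hx
  exact ⟨hf.1.congr h', by rw [← integral_congr_ae h', hf.2]⟩

end Null

section Test

variable {n : ℕ} {k m : WithTop ℕ∞} {f g w : EuclideanSpace ℝ (Fin n) → ℝ}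

theorem IsTest.of_le (hf : IsTest k f) (h : m ≤ k) : IsTest m f :=
  ⟨hf.contDiff.of_le h, hf.compact, hf.zero_notMem⟩

theorem IsTest.integrable (hf : IsTest k f) : Integrable f :=
  hf.contDiff.continuous.integrable_of_hasCompactSupport hf.compact

theorem tsupport_pderiv_subset (i : Fin n) : tsupport (pderiv i f) ⊆ tsupport f :=
  closure_minimal (fun x hx => by
    refine support_fderiv_subset ℝ (f := f) ?_
    intro h0
    apply hx
    simp [pderiv, h0]) (isClosed_tsupport f)

theorem IsTest.pderiv (hf : IsTest k f) (h : m + 1 ≤ k) (i : Fin n) :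
    IsTest m (pderiv i f) :=
  ⟨(hf.contDiff.fderiv_right h).clm_apply contDiff_const,
    hf.compact.mono' (subset_closure.trans (tsupport_pderiv_subset i)),
    fun h0 => hf.zero_notMem (tsupport_pderiv_subset i h0)⟩

theorem IsTest.mul_left (hf : IsTest k f) (hw : ∀ x ≠ 0, ContDiffAt ℝ k w x) :
    IsTest k fun x => w x * f x := by
  have hs : tsupport (fun x => w x * f x) ⊆ tsupport f := tsupport_mul_subset_right
  refine ⟨contDiff_iff_contDiffAt.2 fun x => ?_, hf.compact.mul_left,
    fun h0 => hf.zero_notMem (hs h0)⟩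
  by_cases hx : x ∈ tsupport fun x => w x * f x
  swap
  · exact contDiffAt_const.congr_of_eventuallyEq (notMem_tsupport_iff_eventuallyEq.1 hx)
  have hx0 : x ≠ 0 := by
    rintro rfl
    exact hf.zero_notMem (hs hx)
  exact (hw x hx0).mul hf.contDiff.contDiffAt

theorem IsTest.mul (hf : IsTest k f) (hg : IsTest k g) : IsTest k fun x => f x * g x :=
  hg.mul_left fun _ _ => hf.contDiff.contDiffAt

theorem IsTest.add (hf : IsTest k f) (hg : IsTest k g) : IsTest k fun x => f x + g x :=
  ⟨hf.contDiff.add hg.contDiff, hf.compact.add hg.compact, fun h0 =>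
    (tsupport_add f g h0).elim hf.zero_notMem hg.zero_notMem⟩

theorem IsTest.zero : IsTest k (fun _ : EuclideanSpace ℝ (Fin n) => (0 : ℝ)) :=
  ⟨contDiff_const, HasCompactSupport.zero, by simp [tsupport]⟩

theorem IsTest.sum {ι : Type*} (s : Finset ι) {F : ι → EuclideanSpace ℝ (Fin n) → ℝ}
    (hF : ∀ i ∈ s, IsTest k (F i)) : IsTest k fun x => ∑ i ∈ s, F i x := by
  classical
  induction s using Finset.induction_on with
  | empty => simpa using IsTest.zero
  | insert a s ha ih =>
    simp only [Finset.sum_insert ha]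
    exact (hF a (by simp)).add (ih fun i hi => hF i (by simp [hi]))

theorem contDiffAt_norm_rpow {x : EuclideanSpace ℝ (Fin n)} (hx : x ≠ 0) (a : ℝ) :
    ContDiffAt ℝ k (fun x : EuclideanSpace ℝ (Fin n) => ‖x‖ ^ a) x :=
  (contDiffAt_norm ℝ hx).rpow_const_of_ne (norm_ne_zero_iff.2 hx)

theorem IsTest.rpow_mul (hf : IsTest k f) (a : ℝ) : IsTest k fun x => ‖x‖ ^ a * f x :=
  hf.mul_left fun _ hx => contDiffAt_norm_rpow hx a

theorem contDiff_coord (i : Fin n) : ContDiff ℝ k fun x : EuclideanSpace ℝ (Fin n) => x i :=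
  (EuclideanSpace.proj i : EuclideanSpace ℝ (Fin n) →L[ℝ] ℝ).contDiff

theorem IsTest.coord_mul (hf : IsTest k f) (i : Fin n) : IsTest k fun x => x i * f x :=
  hf.mul_left fun _ _ => (contDiff_coord i).contDiffAt

end Test

section PDeriv

variable {n : ℕ} {f g : EuclideanSpace ℝ (Fin n) → ℝ} {x : EuclideanSpace ℝ (Fin n)}

theorem pderiv_mul (hf : DifferentiableAt ℝ f x) (hg : DifferentiableAt ℝ g x) (i : Fin n) :
    pderiv i (fun x => f x * g x) x = f x * pderiv i g x + pderiv i f x * g x := by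
  simp only [pderiv]
  rw [fderiv_fun_mul hf hg]
  simp
  ring

theorem pderiv_sum {ι : Type*} {s : Finset ι} {F : ι → EuclideanSpace ℝ (Fin n) → ℝ}
    (hF : ∀ i ∈ s, DifferentiableAt ℝ (F i) x) (i : Fin n) :
    pderiv i (fun x => ∑ j ∈ s, F j x) x = ∑ j ∈ s, pderiv i (F j) x := by
  simp only [pderiv]
  rw [fderiv_fun_sum hF]
  simp

theorem pderiv_coord (i j : Fin n) :
    pderiv i (fun x : EuclideanSpace ℝ (Fin n) => x j) x = if j = i then 1 else 0 := by
  have := (EuclideanSpace.proj j : EuclideanSpace ℝ (Fin n) →L[ℝ] ℝ).fderiv (x := x)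
  simp only [pderiv]
  change fderiv ℝ (EuclideanSpace.proj j : EuclideanSpace ℝ (Fin n) →L[ℝ] ℝ) x _ = _
  rw [this]
  simp

theorem hasFDerivAt_norm_of_ne (hx : x ≠ 0) :
    HasFDerivAt (fun x : EuclideanSpace ℝ (Fin n) => ‖x‖) (‖x‖⁻¹ • innerSL ℝ x) x := by
  have h := ((hasStrictFDerivAt_norm_sq x).hasFDerivAt).sqrt (by simpa using hx)
  simp only [Real.sqrt_sq (norm_nonneg _)] at h
  refine h.congr_fderiv ?_
  ext v
  simp
  ring

theorem pderiv_norm_rpow (hx : x ≠ 0) (a : ℝ) (i : Fin n) :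
    pderiv i (fun x => ‖x‖ ^ a) x = a * ‖x‖ ^ (a - 2) * x i := by
  have hpos : 0 < ‖x‖ := norm_pos_iff.2 hx
  have h := (hasFDerivAt_norm_of_ne hx).rpow_const (p := a) (Or.inl hpos.ne')
  rw [pderiv, h.fderiv]
  have e : ‖x‖ ^ (a - 2) = ‖x‖ ^ (a - 1) * ‖x‖⁻¹ := by
    rw [← Real.rpow_neg_one, ← Real.rpow_add hpos]
    ring_nf
  simp [e, EuclideanSpace.inner_single_right]
  ring

theorem pderiv_rpow_mul (hx : x ≠ 0) (hf : DifferentiableAt ℝ f x) (a : ℝ) (i : Fin n) :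
    pderiv i (fun x => ‖x‖ ^ a * f x) x =
      ‖x‖ ^ a * pderiv i f x + a * ‖x‖ ^ (a - 2) * x i * f x := by
  rw [pderiv_mul ((contDiffAt_norm_rpow (k := 1) hx a).differentiableAt (by norm_num)) hf,
    pderiv_norm_rpow hx]

theorem gradient_apply (i : Fin n) : gradient f x i = pderiv i f x := by
  have h : inner ℝ (gradient f x) (EuclideanSpace.single i 1) = pderiv i f x := by
    simp [gradient, pderiv]
  rw [← h, EuclideanSpace.inner_single_right]
  simp

theorem norm_gradient_sq : ‖gradient f x‖ ^ 2 = ∑ i, pderiv i f x ^ 2 := by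
  simp [EuclideanSpace.norm_sq_eq, gradient_apply]

theorem pderiv_pderiv (hf : ContDiff ℝ 2 f) (i j : Fin n) :
    pderiv i (pderiv j f) x =
      fderiv ℝ (fderiv ℝ f) x (EuclideanSpace.single i 1) (EuclideanSpace.single j 1) := by
  have h : DifferentiableAt ℝ (fderiv ℝ f) x :=
    (hf.fderiv_right (m := 1) (by norm_num)).differentiable (by norm_num) x
  have := (h.hasFDerivAt.clm_apply (hasFDerivAt_const (EuclideanSpace.single j (1:ℝ)) x)).fderiv
  rw [pderiv]
  change fderiv ℝ (fun y => fderiv ℝ f y (EuclideanSpace.single j 1)) x _ = _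
  rw [this]
  simp

theorem pderiv_comm (hf : ContDiff ℝ 2 f) (i j : Fin n) :
    pderiv i (pderiv j f) x = pderiv j (pderiv i f) x := by
  rw [pderiv_pderiv hf, pderiv_pderiv hf]
  exact (hf.contDiffAt.isSymmSndFDerivAt (by simp)).eq _ _

theorem lap_eq (hf : ContDiff ℝ 2 f) : lap f x = ∑ i, pderiv i (pderiv i f) x := by
  simp [lap, iteratedFDeriv_two_apply, pderiv_pderiv hf]

end PDeriv

section Integration

variable {n : ℕ} {f g p q : EuclideanSpace ℝ (Fin n) → ℝ}

theorem integral_pderiv_eq_zero (hf : IsTest 1 f) (i : Fin n) : ∫ x, pderiv i f x = 0 := by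
  have h := integral_mul_fderiv_eq_neg_fderiv_mul_of_integrable
    (μ := (volume : Measure (EuclideanSpace ℝ (Fin n))))
    (f := fun _ => (1 : ℝ)) (g := f) (v := EuclideanSpace.single i 1)
    (by simp) (by simpa using! (hf.pderiv (m := 0) (by norm_num) i).integrable)
    (by simpa using hf.integrable) (fun _ _ => differentiableAt_const _)
    (fun x _ => hf.contDiff.differentiable (by norm_num) x)
  simpa using! h

theorem hasDerivAt_integral_mul_translate (hf : IsTest 0 f) (hg : IsTest 1 g)
    (v : EuclideanSpace ℝ (Fin n)) :
    HasDerivAt (fun t : ℝ => ∫ x, f x * g (x + t • v)) (∫ x, f x * fderiv ℝ g x v) 0 := by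
  have hg' : Continuous fun x => fderiv ℝ g x v :=
    (hg.contDiff.continuous_fderiv (by norm_num)).clm_apply continuous_const
  obtain ⟨C, hC⟩ := (hg.compact.fderiv_apply (𝕜 := ℝ) v).exists_bound_of_continuous hg'
  have hfc := hf.contDiff.continuous
  have hgc := hg.contDiff.continuous
  have key := (hasDerivAt_integral_of_dominated_loc_of_deriv_le (𝕜 := ℝ) (μ := volume)
    (F := fun t x => f x * g (x + t • v)) (x₀ := 0) (s := Set.univ) (bound := fun x => ‖f x‖ * C)
    (F' := fun t x => f x * fderiv ℝ g (x + t • v) v) Filter.univ_mem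
    (Filter.Eventually.of_forall fun t => (by fun_prop : Continuous _).aestronglyMeasurable)
    (by simpa using (hf.mul (hg.of_le (by norm_num))).integrable)
    (by simpa using! (hfc.mul hg').aestronglyMeasurable)
    (Filter.Eventually.of_forall fun x t _ => by
      rw [norm_mul]
      exact mul_le_mul_of_nonneg_left (hC _) (norm_nonneg _))
    (hf.integrable.norm.mul_const C)
    (Filter.Eventually.of_forall fun x t _ => by
      have h1 : HasDerivAt (fun t : ℝ => x + t • v) v t := by
        simpa using ((hasDerivAt_id t).smul_const v).const_add x
      exact ((hg.contDiff.differentiable (by norm_num) _).hasFDerivAt.comp_hasDerivAt t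
        h1).const_mul (f x))).2
  simpa using key

theorem integral_pderiv_mul_pderiv_comm (hp : IsTest 1 p) (hq : IsTest 1 q) (i j : Fin n) :
    ∫ x, pderiv i p x * pderiv j q x = ∫ x, pderiv j p x * pderiv i q x := by
  set v : EuclideanSpace ℝ (Fin n) := EuclideanSpace.single j 1 with hv
  have hpi := hp.pderiv (m := 0) (by norm_num) i
  have hqi := hq.pderiv (m := 0) (by norm_num) i
  have h1 := hasDerivAt_integral_mul_translate hpi hq v
  have h2 := hasDerivAt_integral_mul_translate hqi hp (-v)
  have e : (fun t : ℝ => ∫ x, pderiv i p x * q (x + t • v)) =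
      fun t : ℝ => -∫ x, pderiv i q x * p (x + t • -v) := by
    funext t
    have hqt : ContDiff ℝ 1 fun x => q (x + t • v) :=
      hq.contDiff.comp (contDiff_id.add contDiff_const)
    have hd : ∀ x, fderiv ℝ (fun x => q (x + t • v)) x = fderiv ℝ q (x + t • v) := fun x =>
      fderiv_comp_add_right _
    have hpc := hp.contDiff.continuous
    have hqc := hqt.continuous
    have hpic : Continuous fun x => fderiv ℝ p x (EuclideanSpace.single i 1) :=
      hpi.contDiff.continuous
    have hqic : Continuous fun x => fderiv ℝ (fun x => q (x + t • v)) x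
        (EuclideanSpace.single i 1) :=
      (hqt.continuous_fderiv (by norm_num)).clm_apply continuous_const
    have ibp := integral_mul_fderiv_eq_neg_fderiv_mul_of_integrable
      (μ := (volume : Measure (EuclideanSpace ℝ (Fin n))))
      (f := p) (g := fun x => q (x + t • v)) (v := EuclideanSpace.single i 1)
      ((hpic.mul hqc).integrable_of_hasCompactSupport hpi.compact.mul_right)
      ((hpc.mul hqic).integrable_of_hasCompactSupport hp.compact.mul_right)
      ((hpc.mul hqc).integrable_of_hasCompactSupport hp.compact.mul_right)
      (fun x _ => hp.contDiff.differentiable (by norm_num) x)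
      (fun x _ => hqt.differentiable (by norm_num) x)
    simp only [hd] at ibp
    have sub := integral_add_right_eq_self (μ := (volume : Measure (EuclideanSpace ℝ (Fin n))))
      (fun x => pderiv i q x * p (x + t • -v)) (t • v)
    rw [← sub]
    simp only [smul_neg, add_neg_cancel_right]
    simpa only [pderiv, mul_comm] using! (neg_eq_iff_eq_neg.2 ibp).symm
  rw [e] at h1
  have := h1.unique h2.neg
  simp only [map_neg, mul_neg, integral_neg, neg_neg] at this
  simpa only [pderiv, mul_comm] using! this

theorem isNull_pderiv (hf : IsTest 1 f) (i : Fin n) : IsNull (pderiv i f) :=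
  ⟨(hf.pderiv (m := 0) (by norm_num) i).integrable, integral_pderiv_eq_zero hf i⟩

theorem isNull_jacobian (hp : IsTest 1 p) (hq : IsTest 1 q) (i j : Fin n) :
    IsNull fun x => pderiv i p x * pderiv j q x - pderiv j p x * pderiv i q x := by
  have h (i j : Fin n) : Integrable fun x => pderiv i p x * pderiv j q x :=
    ((hp.pderiv (m := 0) (by norm_num) i).mul (hq.pderiv (m := 0) (by norm_num) j)).integrable
  exact ⟨(h i j).sub (h j i), by
    rw [integral_sub (h i j) (h j i), integral_pderiv_mul_pderiv_comm hp hq, sub_self]⟩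

/-- The divergence theorem for the vector field `‖x‖ ^ a • F x`. -/
theorem isNull_div [NeZero n] {F : Fin n → EuclideanSpace ℝ (Fin n) → ℝ}
    (hF : ∀ i, IsTest 1 (F i)) (a : ℝ) :
    IsNull fun x => ‖x‖ ^ a * (∑ i, pderiv i (F i) x) + a * ‖x‖ ^ (a - 2) * ∑ i, x i * F i x := by
  refine (IsNull.sum (s := Finset.univ) fun i _ => isNull_pderiv ((hF i).rpow_mul a) i).congr
    fun x hx => ?_
  rw [Finset.mul_sum, Finset.mul_sum, ← Finset.sum_add_distrib]
  refine Finset.sum_congr rfl fun i _ => ?_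
  rw [pderiv_rpow_mul hx ((hF i).contDiff.differentiable (by norm_num) x)]
  ring

theorem isNull_weighted_jacobian [NeZero n] (hp : IsTest 1 p) (hq : IsTest 1 q) (a : ℝ)
    (i j : Fin n) :
    IsNull fun x => ‖x‖ ^ a * (pderiv i p x * pderiv j q x - pderiv j p x * pderiv i q x) +
      a * ‖x‖ ^ (a - 2) * (p x * (x i * pderiv j q x - x j * pderiv i q x)) := by
  refine (isNull_jacobian (hp.rpow_mul a) hq i j).congr fun x hx => ?_
  have hd := hp.contDiff.differentiable (by norm_num) x
  rw [pderiv_rpow_mul hx hd, pderiv_rpow_mul hx hd]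
  ring

end Integration

section Algebra

variable {n : ℕ}

theorem sq_radial_le (x g k : Fin n → ℝ) :
    (∑ j, x j * k j + ∑ j, x j * g j) ^ 2 ≤
      (∑ j, x j ^ 2) * (∑ j, k j ^ 2 + 2 * ∑ j, k j * g j + ∑ j, g j ^ 2) := by
  have h := Finset.sum_mul_sq_le_sq_mul_sq Finset.univ x fun j => k j + g j
  have e : ∑ j, (k j + g j) ^ 2 = ∑ j, k j ^ 2 + 2 * ∑ j, k j * g j + ∑ j, g j ^ 2 := by
    rw [Finset.mul_sum, ← Finset.sum_add_distrib, ← Finset.sum_add_distrib]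
    exact Finset.sum_congr rfl fun j _ => by ring
  simpa only [mul_add, Finset.sum_add_distrib, e] using h

/-- The tangential part of a symmetric matrix dominates its normalized trace. -/
theorem sq_tangential_trace_le (x : Fin n → ℝ) (h : Fin n → Fin n → ℝ)
    (hsymm : ∀ i j, h i j = h j i) (hx : 0 < ∑ j, x j ^ 2) :
    ((∑ j, x j ^ 2) * (∑ i, h i i) - ∑ j, x j * ∑ i, x i * h i j) ^ 2 ≤
      ((n : ℝ) - 1) * ((∑ j, x j ^ 2) ^ 2 * (∑ i, ∑ j, h i j ^ 2) -
        2 * (∑ j, x j ^ 2) * (∑ j, (∑ i, x i * h i j) ^ 2) +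
        (∑ j, x j * ∑ i, x i * h i j) ^ 2) := by
  set ρ := ∑ j, x j ^ 2 with hρ
  set k : Fin n → ℝ := fun j => ∑ i, x i * h i j with hk
  set s := ∑ j, x j * k j with hs
  have hk' : ∀ i, ∑ j, x j * h i j = k i := fun i => by simp only [hk, hsymm i]
  set B : Fin n × Fin n → ℝ := fun z =>
    ρ ^ 2 * h z.1 z.2 - ρ * k z.1 * x z.2 - ρ * x z.1 * k z.2 + s * x z.1 * x z.2 with hB
  set P : Fin n × Fin n → ℝ := fun z => ρ * (if z.1 = z.2 then 1 else 0) - x z.1 * x z.2 with hP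
  have hrow : ∀ i, ∑ j, B (i, j) * P (i, j) = ρ * B (i, i) := by
    intro i
    have e : ∀ j, B (i, j) * P (i, j) = ρ * (if i = j then B (i, j) else 0) -
        (x i * ρ ^ 2 * (x j * h i j) - x i * (ρ * k i - s * x i) * x j ^ 2
          - x i ^ 2 * ρ * (x j * k j)) := by
      intro j
      simp only [hB, hP]
      split_ifs <;> ring
    simp only [e, Finset.sum_sub_distrib, ← Finset.mul_sum, hk', ← hρ, ← hs]
    simp
    ring
  have hBP : ∑ z, B z * P z = ρ ^ 2 * (ρ * (∑ i, h i i) - s) := by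
    rw [Fintype.sum_prod_type]
    have e : ∀ i, ρ * B (i, i) =
        ρ ^ 3 * h i i - 2 * ρ ^ 2 * (x i * k i) + ρ * s * x i ^ 2 := fun i => by
      simp only [hB]; ring
    simp only [hrow, e, Finset.sum_sub_distrib, Finset.sum_add_distrib, ← Finset.mul_sum, ← hρ,
      ← hs]
    ring
  have hPP : ∑ z, P z ^ 2 = ((n : ℝ) - 1) * ρ ^ 2 := by
    rw [Fintype.sum_prod_type]
    have e : ∀ i j, P (i, j) ^ 2 = (if i = j then ρ ^ 2 - 2 * ρ * (x i * x j) else 0) +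
        x i ^ 2 * x j ^ 2 := fun i j => by
      simp only [hP]
      split_ifs <;> ring
    simp only [e, Finset.sum_add_distrib, ← Finset.mul_sum, ← Finset.sum_mul, ← hρ]
    simp only [Finset.sum_ite_eq, Finset.mem_univ, if_true, Finset.sum_sub_distrib,
      ← Finset.mul_sum, ← pow_two, ← hρ]
    simp
    ring
  have hBB : ∑ z, B z ^ 2 =
      ρ ^ 2 * (ρ ^ 2 * (∑ i, ∑ j, h i j ^ 2) - 2 * ρ * (∑ j, k j ^ 2) + s ^ 2) := by
    rw [Fintype.sum_prod_type]
    have e : ∀ i j, B (i, j) ^ 2 = ρ ^ 4 * h i j ^ 2 - 2 * ρ ^ 3 * (k i * (x j * h i j))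
        - 2 * ρ ^ 3 * (k j * (x i * h i j)) + 2 * ρ ^ 2 * s * (x i * (x j * h i j))
        + ρ ^ 2 * (k i ^ 2 * x j ^ 2) + 2 * ρ ^ 2 * ((x i * k i) * (x j * k j))
        + ρ ^ 2 * (x i ^ 2 * k j ^ 2) - 2 * ρ * s * ((x i * k i) * x j ^ 2)
        - 2 * ρ * s * (x i ^ 2 * (x j * k j)) + s ^ 2 * (x i ^ 2 * x j ^ 2) := fun i j => by
      simp only [hB]; ring
    have e1 : ∑ i, ∑ j, k j * (x i * h i j) = ∑ j, k j ^ 2 := by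
      rw [Finset.sum_comm]
      simp only [← Finset.mul_sum]
      exact Finset.sum_congr rfl fun j _ => by rw [pow_two]
    simp only [e, Finset.sum_sub_distrib, Finset.sum_add_distrib, ← Finset.mul_sum,
      ← Finset.sum_mul, hk', e1, ← hρ, ← hs, ← pow_two]
    ring
  have hCS := Finset.sum_mul_sq_le_sq_mul_sq Finset.univ B P
  rw [hBP, hPP, hBB] at hCS
  have h4 : 0 < ρ ^ 4 := by positivity
  refine le_of_mul_le_mul_left ?_ h4
  calc _ = (ρ ^ 2 * (ρ * (∑ i, h i i) - s)) ^ 2 := by ring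
    _ ≤ _ := hCS
    _ = _ := by ring

end Algebra

section Identities

variable {n : ℕ} {u : EuclideanSpace ℝ (Fin n) → ℝ} {x : EuclideanSpace ℝ (Fin n)}

/-- The Euler derivative `x · ∇u`. -/
noncomputable def euler (u : EuclideanSpace ℝ (Fin n) → ℝ) (x : EuclideanSpace ℝ (Fin n)) : ℝ :=
  ∑ j, x j * pderiv j u x

/-- The components of the Hessian of `u` applied to the position vector. -/
noncomputable def hessVec (j : Fin n) (u : EuclideanSpace ℝ (Fin n) → ℝ)
    (x : EuclideanSpace ℝ (Fin n)) : ℝ :=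
  ∑ i, x i * pderiv i (pderiv j u) x

theorem hessVec_eq (hu : ContDiff ℝ 2 u) (j : Fin n) :
    ∑ i, x i * pderiv j (pderiv i u) x = hessVec j u x :=
  Finset.sum_congr rfl fun i _ => by rw [pderiv_comm hu]

theorem sum_coord_sq : ∑ j, x j ^ 2 = ‖x‖ ^ 2 := by
  simp [EuclideanSpace.norm_sq_eq]

theorem IsTest.pderiv_one (hu : IsTest 2 u) (i : Fin n) : IsTest 1 (_root_.pderiv i u) :=
  hu.pderiv (by norm_num [one_add_one_eq_two]) i

theorem IsTest.differentiableAt (hu : IsTest 1 u) : DifferentiableAt ℝ u x :=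
  hu.contDiff.differentiable (by norm_num) x

theorem IsTest.euler (hu : IsTest 2 u) : IsTest 1 (euler u) :=
  IsTest.sum _ fun j _ => (hu.pderiv_one j).coord_mul j

theorem pderiv_coord_mul (hu : DifferentiableAt ℝ u x) (i j : Fin n) :
    pderiv i (fun x => x j * u x) x = x j * pderiv i u x + if j = i then u x else 0 := by
  rw [pderiv_mul ((contDiff_coord (k := 1) j).differentiable (by norm_num) x) hu, pderiv_coord]
  simp

theorem pderiv_euler (hu : IsTest 2 u) (i : Fin n) :
    pderiv i (euler u) x = pderiv i u x + hessVec i u x := by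
  have hd (j : Fin n) := (hu.pderiv_one j).differentiableAt (x := x)
  change pderiv i (fun x => ∑ j, x j * pderiv j u x) x = _
  rw [pderiv_sum fun j _ => ((hu.pderiv_one j).coord_mul j).differentiableAt]
  simp only [pderiv_coord_mul (hd _), Finset.sum_add_distrib, hessVec_eq hu.contDiff]
  simp [add_comm]

/-- For a vector field `P`, the integrals of `div P * Δu` and `tr (DP * D²u)` agree; here this is
applied to `‖x‖ ^ a • p`. -/
theorem isNull_div_mul_lap [NeZero n] {p : Fin n → EuclideanSpace ℝ (Fin n) → ℝ}
    (hp : ∀ i, IsTest 1 (p i)) (hu : IsTest 2 u) (a : ℝ) :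
    IsNull fun x => ‖x‖ ^ a * ((∑ i, pderiv i (p i) x) * lap u x -
        ∑ i, ∑ j, pderiv j (p i) x * pderiv i (pderiv j u) x) +
      a * ‖x‖ ^ (a - 2) * ((∑ i, x i * p i x) * lap u x - ∑ i, p i x * hessVec i u x) := by
  refine (IsNull.sum (s := Finset.univ) fun i _ => IsNull.sum (s := Finset.univ) fun j _ =>
    isNull_weighted_jacobian (hp i) (hu.pderiv_one j) a i j).congr fun x _ => ?_
  simp only [← hessVec_eq hu.contDiff, lap_eq hu.contDiff, Finset.sum_mul, Finset.mul_sum,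
    Finset.sum_add_distrib, mul_sub, Finset.sum_sub_distrib]
  simp only [mul_assoc, mul_left_comm]
  congr 1 <;> (congr 1; exact Finset.sum_comm)

theorem isNull_bochner [NeZero n] (hu : IsTest 2 u) :
    IsNull fun x => ‖x‖ ^ (4 - (n : ℝ)) * (lap u x ^ 2 - ∑ i, ∑ j, pderiv i (pderiv j u) x ^ 2) +
      (4 - (n : ℝ)) * ‖x‖ ^ (2 - (n : ℝ)) *
        (euler u x * lap u x - ∑ j, hessVec j u x * pderiv j u x) := by
  refine (isNull_div_mul_lap hu.pderiv_one hu (4 - (n : ℝ))).congr fun x _ => ?_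
  have e : (4 - (n : ℝ)) - 2 = 2 - n := by ring
  have e2 : ∀ i j, pderiv j (pderiv i u) x * pderiv i (pderiv j u) x =
      pderiv i (pderiv j u) x ^ 2 := fun i j => by
    rw [pderiv_comm hu.contDiff, pow_two]
  simp only [e, e2, ← lap_eq hu.contDiff, mul_comm (hessVec _ u x), euler, pow_two]

theorem isNull_radial_bochner [NeZero n] (hu : IsTest 2 u) :
    IsNull fun x => ‖x‖ ^ (2 - (n : ℝ)) * (((n : ℝ) - 1) * (euler u x * lap u x) +
        (euler u x + ∑ j, x j * hessVec j u x) * lap u x -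
        (∑ j, hessVec j u x * pderiv j u x + ∑ j, hessVec j u x ^ 2)) +
      (2 - (n : ℝ)) * ‖x‖ ^ (-(n : ℝ)) *
        (euler u x * (‖x‖ ^ 2 * lap u x - ∑ j, x j * hessVec j u x)) := by
  refine (isNull_div_mul_lap (fun i => hu.euler.coord_mul i) hu (2 - (n : ℝ))).congr fun x _ => ?_
  have e : (2 - (n : ℝ)) - 2 = -n := by ring
  have hd := hu.euler.differentiableAt (x := x)
  have t1 : ∑ i, pderiv i (fun x => x i * euler u x) x =
      n * euler u x + (euler u x + ∑ j, x j * hessVec j u x) := by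
    have : ∀ i, pderiv i (fun x => x i * euler u x) x =
        x i * pderiv i u x + x i * hessVec i u x + euler u x := fun i => by
      rw [pderiv_coord_mul hd, pderiv_euler hu, if_pos rfl, mul_add]
    simp only [this, Finset.sum_add_distrib, Finset.sum_const, Finset.card_univ, Fintype.card_fin,
      nsmul_eq_mul]
    rw [show ∑ i, x i * pderiv i u x = euler u x from rfl]
    ring
  have t2 : ∑ i, ∑ j, pderiv j (fun x => x i * euler u x) x * pderiv i (pderiv j u) x =
      euler u x * lap u x +
        (∑ j, hessVec j u x * pderiv j u x + ∑ j, hessVec j u x ^ 2) := by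
    rw [Finset.sum_comm, lap_eq hu.contDiff, Finset.mul_sum, ← Finset.sum_add_distrib,
      ← Finset.sum_add_distrib]
    have : ∀ i j, pderiv j (fun x => x i * euler u x) x * pderiv i (pderiv j u) x =
        (pderiv j u x + hessVec j u x) * (x i * pderiv i (pderiv j u) x) +
          if i = j then euler u x * pderiv i (pderiv j u) x else 0 := fun i j => by
      rw [pderiv_coord_mul hd, pderiv_euler hu]
      split_ifs <;> ring
    refine Finset.sum_congr rfl fun j _ => ?_
    simp only [this, Finset.sum_add_distrib, ← Finset.mul_sum, Finset.sum_ite_eq',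
      Finset.mem_univ, if_true]
    rw [show ∑ i, x i * pderiv i (pderiv j u) x = hessVec j u x from rfl]
    ring
  have t3 : ∑ i, x i * (x i * euler u x) = ‖x‖ ^ 2 * euler u x := by
    simp only [← sum_coord_sq, Finset.sum_mul]
    exact Finset.sum_congr rfl fun _ _ => by ring
  have t4 : ∑ i, x i * euler u x * hessVec i u x = euler u x * ∑ j, x j * hessVec j u x := by
    rw [Finset.mul_sum]
    exact Finset.sum_congr rfl fun _ _ => by ring
  rw [t1, t2, t3, t4, e]
  ring

theorem isNull_div_euler_mul_grad [NeZero n] (hu : IsTest 2 u) :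
    IsNull fun x => ‖x‖ ^ (2 - (n : ℝ)) * (∑ j, pderiv j u x ^ 2 +
        ∑ j, hessVec j u x * pderiv j u x + euler u x * lap u x) +
      (2 - (n : ℝ)) * ‖x‖ ^ (-(n : ℝ)) * euler u x ^ 2 := by
  refine (isNull_div (fun i => hu.euler.mul (hu.pderiv_one i)) (2 - (n : ℝ))).congr fun x _ => ?_
  have e : (2 - (n : ℝ)) - 2 = -n := by ring
  have t1 : ∑ i, pderiv i (fun x => euler u x * pderiv i u x) x = ∑ j, pderiv j u x ^ 2 +
        ∑ j, hessVec j u x * pderiv j u x + euler u x * lap u x := by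
    rw [lap_eq hu.contDiff, Finset.mul_sum, ← Finset.sum_add_distrib, ← Finset.sum_add_distrib]
    refine Finset.sum_congr rfl fun i _ => ?_
    rw [pderiv_mul hu.euler.differentiableAt (hu.pderiv_one i).differentiableAt, pderiv_euler hu]
    ring
  have t2 : ∑ i, x i * (euler u x * pderiv i u x) = euler u x ^ 2 := by
    rw [pow_two]
    nth_rw 3 [euler]
    rw [Finset.mul_sum]
    exact Finset.sum_congr rfl fun _ _ => by ring
  rw [t1, t2, e]

theorem isNull_div_gradSq_mul_coord [NeZero n] (hu : IsTest 2 u) :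
    IsNull fun x => ‖x‖ ^ (2 - (n : ℝ)) * (n * ∑ j, pderiv j u x ^ 2 +
        2 * ∑ j, hessVec j u x * pderiv j u x) +
      (2 - (n : ℝ)) * ‖x‖ ^ (-(n : ℝ)) * (‖x‖ ^ 2 * ∑ j, pderiv j u x ^ 2) := by
  have hG : IsTest 1 fun x => ∑ j, pderiv j u x * pderiv j u x :=
    IsTest.sum _ fun j _ => (hu.pderiv_one j).mul (hu.pderiv_one j)
  refine (isNull_div (fun i => hG.coord_mul i) (2 - (n : ℝ))).congr fun x _ => ?_
  have e : (2 - (n : ℝ)) - 2 = -n := by ring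
  have hGi : ∀ i, pderiv i (fun x => ∑ j, pderiv j u x * pderiv j u x) x =
      2 * ∑ j, pderiv j u x * pderiv i (pderiv j u) x := fun i => by
    rw [pderiv_sum fun j _ => ((hu.pderiv_one j).mul (hu.pderiv_one j)).differentiableAt,
      Finset.mul_sum]
    refine Finset.sum_congr rfl fun j _ => ?_
    rw [pderiv_mul (hu.pderiv_one j).differentiableAt (hu.pderiv_one j).differentiableAt]
    ring
  have t1 : ∑ i, pderiv i (fun x => x i * ∑ j, pderiv j u x * pderiv j u x) x =
      n * ∑ j, pderiv j u x ^ 2 + 2 * ∑ j, hessVec j u x * pderiv j u x := by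
    have : ∀ i, pderiv i (fun x => x i * ∑ j, pderiv j u x * pderiv j u x) x =
        ∑ j, pderiv j u x ^ 2 + ∑ j, 2 * (pderiv j u x * (x i * pderiv i (pderiv j u) x)) :=
      fun i => by
        rw [pderiv_coord_mul hG.differentiableAt, hGi, if_pos rfl, add_comm]
        simp only [← pow_two, Finset.mul_sum]
        congr 1
        exact Finset.sum_congr rfl fun _ _ => by ring
    simp only [this, Finset.sum_add_distrib, Finset.sum_const, Finset.card_univ, Fintype.card_fin,
      nsmul_eq_mul]
    rw [Finset.sum_comm]
    simp only [← Finset.mul_sum]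
    simp only [hessVec, mul_comm]
  have t2 : ∑ i, x i * (x i * ∑ j, pderiv j u x * pderiv j u x) =
      ‖x‖ ^ 2 * ∑ j, pderiv j u x ^ 2 := by
    simp only [← sum_coord_sq, Finset.sum_mul, ← pow_two]
    exact Finset.sum_congr rfl fun _ _ => by ring
  rw [t1, t2, e]

theorem isNull_div_euler_sq_mul_coord [NeZero n] (hu : IsTest 2 u) :
    IsNull fun x => ‖x‖ ^ (-(n : ℝ)) * (n * euler u x ^ 2 +
        2 * euler u x * (euler u x + ∑ j, x j * hessVec j u x)) +
      -(n : ℝ) * ‖x‖ ^ (-(n : ℝ) - 2) * (‖x‖ ^ 2 * euler u x ^ 2) := by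
  have hG : IsTest 1 fun x => euler u x * euler u x := hu.euler.mul hu.euler
  refine (isNull_div (fun i => hG.coord_mul i) (-(n : ℝ))).congr fun x _ => ?_
  have t1 : ∑ i, pderiv i (fun x => x i * (euler u x * euler u x)) x =
      n * euler u x ^ 2 + 2 * euler u x * (euler u x + ∑ j, x j * hessVec j u x) := by
    have : ∀ i, pderiv i (fun x => x i * (euler u x * euler u x)) x =
        2 * euler u x * (x i * pderiv i u x) + 2 * euler u x * (x i * hessVec i u x) +
          euler u x ^ 2 := fun i => by
      rw [pderiv_coord_mul hG.differentiableAt,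
        pderiv_mul hu.euler.differentiableAt hu.euler.differentiableAt, pderiv_euler hu, if_pos rfl]
      ring
    simp only [this, Finset.sum_add_distrib, ← Finset.mul_sum]
    simp only [Finset.sum_const, Finset.card_univ, Fintype.card_fin, nsmul_eq_mul]
    simp only [euler]
    ring
  have t2 : ∑ i, x i * (x i * (euler u x * euler u x)) = ‖x‖ ^ 2 * euler u x ^ 2 := by
    simp only [← sum_coord_sq, Finset.sum_mul]
    exact Finset.sum_congr rfl fun _ _ => by ring
  rw [t1, t2]

end Identities

section LowerBound

variable {n : ℕ} {u : EuclideanSpace ℝ (Fin n) → ℝ} {x : EuclideanSpace ℝ (Fin n)}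

theorem IsTest.integrable_lap_sq (hu : IsTest 2 u) (a : ℝ) :
    Integrable fun x => ‖x‖ ^ a * lap u x ^ 2 := by
  have h : IsTest 0 (lap u) := by
    rw [show lap u = fun x => ∑ i, _root_.pderiv i (_root_.pderiv i u) x from
      funext fun x => lap_eq hu.contDiff]
    exact IsTest.sum _ fun i _ => (hu.pderiv_one i).pderiv (by norm_num) i
  simpa only [pow_two] using ((h.mul h).rpow_mul a).integrable

theorem IsTest.integrable_gradient_sq (hu : IsTest 2 u) (a : ℝ) :
    Integrable fun x => ‖x‖ ^ a * ‖gradient u x‖ ^ 2 := by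
  have h : IsTest 1 fun x => ∑ i, _root_.pderiv i u x * _root_.pderiv i u x :=
    IsTest.sum _ fun i _ => (hu.pderiv_one i).mul (hu.pderiv_one i)
  simp only [norm_gradient_sq]
  simpa only [pow_two] using (h.rpow_mul a).integrable

theorem rpow_sub_natCast_mul {r : ℝ} (hr : 0 < r) (b : ℝ) (k : ℕ) :
    r ^ ((k : ℝ) - b) = r ^ (-b) * r ^ k := by
  rw [← Real.rpow_natCast r k, ← Real.rpow_add hr]
  ring_nf

theorem rellich_lower_bound (hn : 3 ≤ n) (hu : IsTest 2 u) {C : ℝ}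
    (hC₁ : C ≤ ((n : ℝ) - 2) ^ 2) (hC₂ : C ≤ (n : ℝ) - 1) :
    C * ∫ x, ‖x‖ ^ (2 - (n : ℝ)) * ‖gradient u x‖ ^ 2 ≤
      ∫ x, ‖x‖ ^ (4 - (n : ℝ)) * lap u x ^ 2 := by
  have : NeZero n := ⟨by omega⟩
  have hn' : (3 : ℝ) ≤ n := by exact_mod_cast hn
  have hn2 : (0 : ℝ) < n - 2 := by linarith
  set ν : ℝ := (n : ℝ) with hν
  set c₂ : ℝ := (ν ^ 2 - 5 * ν + 8) / (ν - 2) with hc₂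
  set c₃ : ℝ := -(ν + 1) - c₂ with hc₃
  set c₄ : ℝ := -2 + 2 / (ν - 2) * (ν - 1) - 2 * c₂ - c₃ with hc₄
  have hR := (((((isNull_bochner hu).const_mul ((ν - 1) / (ν - 2))).sub
    ((isNull_radial_bochner hu).const_mul (2 / (ν - 2)))).add
    ((isNull_div_euler_mul_grad hu).const_mul c₂)).add
    ((isNull_div_gradSq_mul_coord hu).const_mul (c₃ / 2))).add
    ((isNull_div_euler_sq_mul_coord hu).const_mul (c₄ / 2))
  simp only [← hν] at hR
  rw [← integral_const_mul, ← add_zero (∫ x, C * (‖x‖ ^ (2 - ν) * ‖gradient u x‖ ^ 2)), ← hR.2,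
    ← integral_add ((hu.integrable_gradient_sq _).const_mul C) hR.1]
  refine integral_mono_ae (((hu.integrable_gradient_sq _).const_mul C).add hR.1)
    (hu.integrable_lap_sq _) ?_
  filter_upwards [ae_ne_zero] with x hx
  have hr : 0 < ‖x‖ := norm_pos_iff.2 hx
  have hq : 0 < ‖x‖ ^ (-ν) := Real.rpow_pos_of_pos hr _
  have e4 : ‖x‖ ^ (4 - ν) = ‖x‖ ^ (-ν) * ‖x‖ ^ 4 := rpow_sub_natCast_mul hr ν 4
  have e2 : ‖x‖ ^ (2 - ν) = ‖x‖ ^ (-ν) * ‖x‖ ^ 2 := rpow_sub_natCast_mul hr ν 2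
  have em2 : ‖x‖ ^ (-ν - 2) = ‖x‖ ^ (-ν) / ‖x‖ ^ 2 := by
    rw [Real.rpow_sub hr, Real.rpow_two]
  have hcs : euler u x ^ 2 ≤ ‖x‖ ^ 2 * ∑ j, pderiv j u x ^ 2 := by
    rw [← sum_coord_sq]
    exact Finset.sum_mul_sq_le_sq_mul_sq _ _ _
  have hrad := sq_radial_le x (fun j => pderiv j u x) (fun j => hessVec j u x)
  have htan := sq_tangential_trace_le x (fun i j => pderiv i (pderiv j u) x)
    (fun i j => pderiv_comm hu.contDiff i j) (by rw [sum_coord_sq]; positivity)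
  rw [sum_coord_sq] at hrad htan
  rw [← lap_eq hu.contDiff] at htan
  change (_ * _ - ∑ j, x j * hessVec j u x) ^ 2 ≤
    (ν - 1) * (_ - 2 * _ * (∑ j, hessVec j u x ^ 2) + (∑ j, x j * hessVec j u x) ^ 2) at htan
  change (∑ j, x j * hessVec j u x + euler u x) ^ 2 ≤ _ at hrad
  simp only [e4, e2, em2, norm_gradient_sq]
  generalize ‖x‖ ^ (-ν) = q at *
  generalize ‖x‖ = r at *
  generalize euler u x = E at *
  generalize lap u x = L at *
  generalize ∑ j, pderiv j u x ^ 2 = G at *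
  generalize ∑ j, x j * hessVec j u x = S at *
  generalize ∑ j, hessVec j u x * pderiv j u x = K at *
  generalize ∑ j, hessVec j u x ^ 2 = M at *
  generalize ∑ i, ∑ j, pderiv i (pderiv j u) x ^ 2 = H at *
  have hmain : 0 ≤ q * ((S + E) ^ 2 + 2 * (r ^ 2 * (M + 2 * K + G) - (S + E) ^ 2) +
      1 / (ν - 2) * ((ν - 1) * ((r ^ 2) ^ 2 * H - 2 * r ^ 2 * M + S ^ 2) - (r ^ 2 * L - S) ^ 2) +
      (((ν - 2) ^ 2 - C) * E ^ 2 + (ν - 1 - C) * (r ^ 2 * G - E ^ 2))) := by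
    have i1 : 0 ≤ 1 / (ν - 2) *
        ((ν - 1) * ((r ^ 2) ^ 2 * H - 2 * r ^ 2 * M + S ^ 2) - (r ^ 2 * L - S) ^ 2) :=
      mul_nonneg (by positivity) (by linarith)
    have i2 : 0 ≤ ((ν - 2) ^ 2 - C) * E ^ 2 := mul_nonneg (by linarith) (sq_nonneg _)
    have i3 : 0 ≤ (ν - 1 - C) * (r ^ 2 * G - E ^ 2) := mul_nonneg (by linarith) (by linarith)
    have i4 := sq_nonneg (S + E)
    exact mul_nonneg hq.le (by linarith)
  refine sub_nonneg.1 (hmain.trans_eq ?_)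
  simp only [hc₄, hc₃, hc₂]
  have := hn2.ne'
  field_simp
  ring

end LowerBound

section Radial

/-- `K` is of class `C^k` with compact support in the open half-line. -/
structure IsProfile (k : WithTop ℕ∞) (K : ℝ → ℝ) : Prop where
  contDiff : ContDiff ℝ k K
  compact : HasCompactSupport K
  tsupport_subset : tsupport K ⊆ Set.Ioi 0

variable {n : ℕ} {k m : WithTop ℕ∞} {K F : ℝ → ℝ} {u : EuclideanSpace ℝ (Fin n) → ℝ}
  {x : EuclideanSpace ℝ (Fin n)}

theorem IsProfile.of_le (hK : IsProfile k K) (h : m ≤ k) : IsProfile m K :=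
  ⟨hK.contDiff.of_le h, hK.compact, hK.tsupport_subset⟩

theorem IsProfile.deriv (hK : IsProfile k K) (h : m + 1 ≤ k) : IsProfile m (deriv K) :=
  ⟨(contDiff_succ_iff_deriv.1 (hK.contDiff.of_le h)).2.2, hK.compact.deriv,
    (closure_minimal support_deriv_subset (isClosed_tsupport K)).trans hK.tsupport_subset⟩

theorem IsProfile.mul_left {w : ℝ → ℝ} (hK : IsProfile k K) (hw : ContDiff ℝ k w) :
    IsProfile k fun t => w t * K t :=
  ⟨hw.mul hK.contDiff, hK.compact.mul_left, tsupport_mul_subset_right.trans hK.tsupport_subset⟩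

theorem IsProfile.comp_mul_left (hK : IsProfile k K) {s : ℝ} (hs : 0 < s) :
    IsProfile k fun t => K (s * t) := by
  refine ⟨hK.contDiff.comp (contDiff_const.mul contDiff_id),
    hK.compact.comp_homeomorph (Homeomorph.mulLeft₀ s hs.ne'), fun t ht => ?_⟩
  have h : s * t ∈ tsupport K := tsupport_comp_subset_preimage K (continuous_const_mul s) ht
  exact pos_of_mul_pos_right (hK.tsupport_subset h) hs.le

theorem IsProfile.eq_zero (hK : IsProfile k K) {t : ℝ} (ht : t ≤ 0) : K t = 0 :=
  image_eq_zero_of_notMem_tsupport fun h => (hK.tsupport_subset h).not_ge ht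

theorem IsProfile.isTest (hK : IsProfile k K) :
    IsTest k fun x : EuclideanSpace ℝ (Fin n) => K (Real.log ‖x‖) := by
  have h0 : (fun x : EuclideanSpace ℝ (Fin n) => K (Real.log ‖x‖)) =ᶠ[nhds 0] 0 := by
    filter_upwards [Metric.ball_mem_nhds (0 : EuclideanSpace ℝ (Fin n)) one_pos] with x hx
    exact hK.eq_zero (Real.log_nonpos (norm_nonneg x) (mem_ball_zero_iff.1 hx).le)
  refine ⟨contDiff_iff_contDiffAt.2 fun x => ?_, ?_, notMem_tsupport_iff_eventuallyEq.2 h0⟩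
  · by_cases hx : x = 0
    · subst hx
      exact contDiffAt_const.congr_of_eventuallyEq h0
    · exact hK.contDiff.contDiffAt.comp x ((contDiffAt_norm ℝ hx).log (norm_ne_zero_iff.2 hx))
  · obtain ⟨R, hR⟩ := hK.compact.isCompact.isBounded.subset_closedBall 0
    refine HasCompactSupport.intro (isCompact_closedBall 0 (Real.exp R)) fun x hx => ?_
    refine image_eq_zero_of_notMem_tsupport fun h => hx ?_
    have h1 : Real.log ‖x‖ ≤ R := (le_abs_self _).trans (by simpa using hR h)
    by_cases hx0 : x = 0
    · subst hx0
      simpa using (Real.exp_pos R).le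
    · simpa using (Real.log_le_iff_le_exp (norm_pos_iff.2 hx0)).1 h1

theorem pderiv_radial (hK : IsProfile k K) (hk : 1 ≤ k) (i : Fin n) :
    pderiv i (fun x => K (Real.log ‖x‖)) x =
      x i * (‖x‖ ^ (-2 : ℝ) * deriv K (Real.log ‖x‖)) := by
  by_cases hx : x = 0
  · subst hx
    rw [image_eq_zero_of_notMem_tsupport
      ((hK.of_le hk).isTest.pderiv (m := 0) (by simp) i).zero_notMem]
    simp
  have h1 := (hasFDerivAt_norm_of_ne hx).log (norm_ne_zero_iff.2 hx)
  have h2 : HasDerivAt K (deriv K (Real.log ‖x‖)) (Real.log ‖x‖) :=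
    (hK.contDiff.differentiable (by positivity) _).hasDerivAt
  have h3 := h2.comp_hasFDerivAt x h1
  have e : ‖x‖ ^ (-2 : ℝ) = ‖x‖⁻¹ * ‖x‖⁻¹ := by
    rw [Real.rpow_neg (norm_nonneg _), Real.rpow_two, pow_two, mul_inv]
  rw [pderiv]
  change fderiv ℝ (K ∘ fun x => Real.log ‖x‖) x _ = _
  rw [h3.fderiv, e]
  simp [EuclideanSpace.inner_single_right]
  ring

theorem rpow_neg_two_mul_sq {r : ℝ} (hr : 0 < r) : r ^ (-2 : ℝ) * r ^ 2 = 1 := by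
  rw [← Real.rpow_two, ← Real.rpow_add hr]
  norm_num

theorem lap_radial (hK : IsProfile 2 K) (hx : x ≠ 0) :
    lap (fun x => K (Real.log ‖x‖)) x = ‖x‖ ^ (-2 : ℝ) *
      (deriv (deriv K) (Real.log ‖x‖) + ((n : ℝ) - 2) * deriv K (Real.log ‖x‖)) := by
  have hK' : IsProfile 1 (deriv K) := hK.deriv (by norm_num [one_add_one_eq_two])
  have hd : DifferentiableAt ℝ (fun x : EuclideanSpace ℝ (Fin n) => deriv K (Real.log ‖x‖)) x :=
    hK'.isTest.differentiableAt
  have hd' := (hK'.isTest.rpow_mul (-2 : ℝ)).differentiableAt (x := x)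
  have e : ‖x‖ ^ (-2 - 2 : ℝ) * ‖x‖ ^ 2 = ‖x‖ ^ (-2 : ℝ) := by
    rw [← Real.rpow_two, ← Real.rpow_add (norm_pos_iff.2 hx)]
    norm_num
  have e' := rpow_neg_two_mul_sq (norm_pos_iff.2 hx)
  rw [lap_eq hK.isTest.contDiff]
  have (i : Fin n) : pderiv i (pderiv i fun x => K (Real.log ‖x‖)) x =
      x i ^ 2 * (‖x‖ ^ (-2 : ℝ) * (‖x‖ ^ (-2 : ℝ) * deriv (deriv K) (Real.log ‖x‖)) +
        -2 * ‖x‖ ^ (-2 - 2 : ℝ) * deriv K (Real.log ‖x‖)) +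
      ‖x‖ ^ (-2 : ℝ) * deriv K (Real.log ‖x‖) := by
    rw [show pderiv i (fun x : EuclideanSpace ℝ (Fin n) => K (Real.log ‖x‖)) = fun x =>
      x i * (‖x‖ ^ (-2 : ℝ) * deriv K (Real.log ‖x‖)) from
      funext fun x => pderiv_radial hK (by norm_num) i]
    rw [pderiv_coord_mul hd', pderiv_rpow_mul hx hd, pderiv_radial hK' le_rfl]
    simp
    ring
  simp only [this, Finset.sum_add_distrib, ← Finset.sum_mul, sum_coord_sq]
  simp only [Finset.sum_const, Finset.card_univ, Fintype.card_fin, nsmul_eq_mul]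
  generalize ‖x‖ ^ (-2 - 2 : ℝ) = q at *
  generalize ‖x‖ ^ (-2 : ℝ) = p at *
  linear_combination (p * deriv (deriv K) (Real.log ‖x‖)) * e' -
    2 * deriv K (Real.log ‖x‖) * e

theorem lap_coord_mul (hu : IsTest 2 u) (j : Fin n) :
    lap (fun x => x j * u x) x = x j * lap u x + 2 * pderiv j u x := by
  have hd (y) : DifferentiableAt ℝ u y := hu.contDiff.differentiable (by norm_num) y
  rw [lap_eq (hu.coord_mul j).contDiff, lap_eq hu.contDiff]
  have (i : Fin n) : pderiv i (pderiv i fun x => x j * u x) x =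
      x j * pderiv i (pderiv i u) x + if j = i then 2 * pderiv i u x else 0 := by
    rw [show pderiv i (fun x => x j * u x) = fun x =>
      x j * pderiv i u x + (if j = i then 1 else 0) * u x from
      funext fun x => by simp [pderiv_coord_mul (hd x)]]
    rw [pderiv, fderiv_fun_add ((hu.pderiv_one i).coord_mul j).differentiableAt
      ((hd x).const_mul _), fderiv_const_mul (hd x)]
    have := pderiv_coord_mul (hu.pderiv_one i).differentiableAt (x := x) i j
    rw [pderiv] at this
    simp only [add_apply, smul_apply, this]
    change _ + _ * pderiv i u x = _
    split_ifs <;> ring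
  simp [this, Finset.sum_add_distrib, Finset.mul_sum]

end Radial

section RadialIntegrals

variable {n : ℕ} {K F : ℝ → ℝ}

theorem integral_rpow_mul_comp_log_norm [NeZero n] (G : ℝ → ℝ) :
    ∫ x : EuclideanSpace ℝ (Fin n), ‖x‖ ^ (-(n : ℝ)) * G (Real.log ‖x‖) =
      n * volume.real (Metric.ball (0 : EuclideanSpace ℝ (Fin n)) 1) * ∫ t, G t := by
  have : Nontrivial (EuclideanSpace ℝ (Fin n)) := by
    refine ⟨EuclideanSpace.single 0 1, 0, ?_⟩
    simp
  have h := integral_fun_norm_addHaar (volume : Measure (EuclideanSpace ℝ (Fin n)))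
    fun r => r ^ (-(n : ℝ)) * G (Real.log r)
  have hexp := integral_image_eq_integral_abs_deriv_smul MeasurableSet.univ
    (fun t _ => (Real.hasDerivAt_exp t).hasDerivWithinAt) Real.exp_injective.injOn
    fun r => r⁻¹ * G (Real.log r)
  simp only [Set.image_univ, Real.range_exp, Measure.restrict_univ, Real.log_exp,
    abs_of_pos (Real.exp_pos _), smul_eq_mul, mul_inv_cancel_left₀ (Real.exp_ne_zero _)] at hexp
  rw [h, ← hexp, finrank_euclideanSpace_fin, nsmul_eq_mul, smul_eq_mul, mul_assoc]
  congr 2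
  refine setIntegral_congr_fun measurableSet_Ioi fun r (hr : 0 < r) => ?_
  have hn : 1 ≤ n := Nat.one_le_iff_ne_zero.2 (NeZero.ne n)
  have e : r ^ (n - 1) * r ^ (-(n : ℝ)) = r⁻¹ := by
    rw [← Real.rpow_natCast, ← Real.rpow_add hr, Nat.cast_sub hn, ← Real.rpow_neg_one]
    ring_nf
  simp only [smul_eq_mul, ← mul_assoc, e]

theorem integral_lap_radial [NeZero n] (hK : IsProfile 2 K) :
    ∫ x : EuclideanSpace ℝ (Fin n), ‖x‖ ^ (4 - (n : ℝ)) *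
        lap (fun x => K (Real.log ‖x‖)) x ^ 2 =
      n * volume.real (Metric.ball (0 : EuclideanSpace ℝ (Fin n)) 1) *
        ∫ t, (deriv (deriv K) t + ((n : ℝ) - 2) * deriv K t) ^ 2 := by
  rw [← integral_rpow_mul_comp_log_norm fun t => (deriv (deriv K) t + (n - 2) * deriv K t) ^ 2]
  refine integral_congr_ae ?_
  filter_upwards [ae_ne_zero] with x hx
  have hr : 0 < ‖x‖ := norm_pos_iff.2 hx
  have e4 : ‖x‖ ^ (4 - (n : ℝ)) = ‖x‖ ^ (-(n : ℝ)) * ‖x‖ ^ 4 := rpow_sub_natCast_mul hr n 4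
  have e := rpow_neg_two_mul_sq hr
  rw [lap_radial hK hx, e4]
  generalize ‖x‖ ^ (-2 : ℝ) = p at *
  linear_combination ‖x‖ ^ (-(n : ℝ)) *
    (deriv (deriv K) (Real.log ‖x‖) + ((n : ℝ) - 2) * deriv K (Real.log ‖x‖)) ^ 2 *
    (p * ‖x‖ ^ 2 + 1) * e

theorem integral_gradient_radial [NeZero n] (hK : IsProfile 1 K) :
    ∫ x : EuclideanSpace ℝ (Fin n), ‖x‖ ^ (2 - (n : ℝ)) *
        ‖gradient (fun x => K (Real.log ‖x‖)) x‖ ^ 2 =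
      n * volume.real (Metric.ball (0 : EuclideanSpace ℝ (Fin n)) 1) *
        ∫ t, deriv K t ^ 2 := by
  rw [← integral_rpow_mul_comp_log_norm fun t => deriv K t ^ 2]
  refine integral_congr_ae ?_
  filter_upwards [ae_ne_zero] with x hx
  have hr : 0 < ‖x‖ := norm_pos_iff.2 hx
  have e2 : ‖x‖ ^ (2 - (n : ℝ)) = ‖x‖ ^ (-(n : ℝ)) * ‖x‖ ^ 2 := rpow_sub_natCast_mul hr n 2
  have e := rpow_neg_two_mul_sq hr
  simp only [norm_gradient_sq, pderiv_radial hK le_rfl, mul_pow, ← Finset.sum_mul, sum_coord_sq, e2]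
  generalize ‖x‖ ^ (-2 : ℝ) = p at *
  linear_combination ‖x‖ ^ (-(n : ℝ)) * deriv K (Real.log ‖x‖) ^ 2 * (p * ‖x‖ ^ 2 + 1) * e

theorem deriv_exp_neg_mul (hF : Differentiable ℝ F) :
    deriv (fun t => Real.exp (-t) * F t) = fun t => Real.exp (-t) * (deriv F t - F t) := by
  funext t
  have h := (((hasDerivAt_id t).neg.exp).mul (hF t).hasDerivAt).deriv
  simp only [id, Pi.neg_apply] at h
  refine Eq.trans h ?_
  ring

theorem IsProfile.exp_neg_mul {k : WithTop ℕ∞} (hF : IsProfile k F) :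
    IsProfile k fun t => Real.exp (-t) * F t :=
  hF.mul_left (Real.contDiff_exp.comp contDiff_neg)

theorem exp_neg_log_sq {r : ℝ} (hr : 0 < r) : Real.exp (-Real.log r) ^ 2 * r ^ 2 = 1 := by
  rw [Real.exp_neg, Real.exp_log hr, ← mul_pow, inv_mul_cancel₀ hr.ne', one_pow]

theorem sum_integral_lap_coord_mul_radial [NeZero n] (hF : IsProfile 2 F) :
    ∑ j, ∫ x : EuclideanSpace ℝ (Fin n), ‖x‖ ^ (4 - (n : ℝ)) *
        lap (fun x => x j * (Real.exp (-Real.log ‖x‖) * F (Real.log ‖x‖))) x ^ 2 =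
      n * volume.real (Metric.ball (0 : EuclideanSpace ℝ (Fin n)) 1) *
        ∫ t, (deriv (deriv F) t + ((n : ℝ) - 2) * deriv F t - ((n : ℝ) - 1) * F t) ^ 2 := by
  have hT : IsTest 2 fun x : EuclideanSpace ℝ (Fin n) =>
    Real.exp (-Real.log ‖x‖) * F (Real.log ‖x‖) := hF.exp_neg_mul.isTest
  have hd := hF.contDiff.differentiable (by norm_num)
  have hd' := (hF.deriv (m := 1) (by norm_num [one_add_one_eq_two])).contDiff.differentiable
    (by norm_num)
  have hK' := deriv_exp_neg_mul hd
  have hK'' : deriv (fun t => Real.exp (-t) * (deriv F t - F t)) =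
      fun t => Real.exp (-t) * (deriv (deriv F) t - deriv F t - (deriv F t - F t)) := by
    refine (deriv_exp_neg_mul (hd'.sub hd)).trans (funext fun t => ?_)
    rw [deriv_sub (hd' t) (hd t)]
    rfl
  rw [← integral_rpow_mul_comp_log_norm fun t =>
    (deriv (deriv F) t + (n - 2) * deriv F t - (n - 1) * F t) ^ 2,
    ← integral_finsetSum _ fun j _ => (hT.coord_mul j).integrable_lap_sq _]
  refine integral_congr_ae ?_
  filter_upwards [ae_ne_zero] with x hx
  have hr : 0 < ‖x‖ := norm_pos_iff.2 hx
  have e4 : ‖x‖ ^ (4 - (n : ℝ)) = ‖x‖ ^ (-(n : ℝ)) * ‖x‖ ^ 4 := rpow_sub_natCast_mul hr n 4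
  have e := rpow_neg_two_mul_sq hr
  have e' := exp_neg_log_sq hr
  have hl := lap_radial hF.exp_neg_mul hx
  have hp := pderiv_radial (x := x) hF.exp_neg_mul (by norm_num)
  rw [hK', hK''] at hl
  rw [hK'] at hp
  have hlap (j : Fin n) : lap (fun x => x j * (Real.exp (-Real.log ‖x‖) * F (Real.log ‖x‖))) x =
      x j * (‖x‖ ^ (-2 : ℝ) * (Real.exp (-Real.log ‖x‖) * (deriv (deriv F) (Real.log ‖x‖) +
        ((n : ℝ) - 2) * deriv F (Real.log ‖x‖) - ((n : ℝ) - 1) * F (Real.log ‖x‖)))) := by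
    rw [lap_coord_mul hT, hl, hp]
    simp
    ring
  simp only [hlap, mul_pow, ← Finset.mul_sum, ← Finset.sum_mul, sum_coord_sq, e4]
  generalize deriv (deriv F) (Real.log ‖x‖) + _ - _ = A
  generalize ‖x‖ ^ (-2 : ℝ) = p at *
  generalize Real.exp (-Real.log ‖x‖) = y at *
  linear_combination ‖x‖ ^ (-(n : ℝ)) * A ^ 2 *
    ((p * ‖x‖ ^ 2 + 1) * y ^ 2 * ‖x‖ ^ 2 * e + e')

theorem sum_integral_gradient_coord_mul_radial [NeZero n] (hF : IsProfile 2 F) :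
    ∑ j, ∫ x : EuclideanSpace ℝ (Fin n), ‖x‖ ^ (2 - (n : ℝ)) *
        ‖gradient (fun x => x j * (Real.exp (-Real.log ‖x‖) * F (Real.log ‖x‖))) x‖ ^ 2 =
      n * volume.real (Metric.ball (0 : EuclideanSpace ℝ (Fin n)) 1) *
        ∫ t, (deriv F t ^ 2 + ((n : ℝ) - 1) * F t ^ 2) := by
  have hT : IsTest 2 fun x : EuclideanSpace ℝ (Fin n) =>
    Real.exp (-Real.log ‖x‖) * F (Real.log ‖x‖) := hF.exp_neg_mul.isTest
  have hK' := deriv_exp_neg_mul (hF.contDiff.differentiable (by norm_num))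
  rw [← integral_rpow_mul_comp_log_norm fun t => deriv F t ^ 2 + (n - 1) * F t ^ 2,
    ← integral_finsetSum _ fun j _ => (hT.coord_mul j).integrable_gradient_sq _]
  refine integral_congr_ae ?_
  filter_upwards [ae_ne_zero] with x hx
  have hr : 0 < ‖x‖ := norm_pos_iff.2 hx
  have e2 : ‖x‖ ^ (2 - (n : ℝ)) = ‖x‖ ^ (-(n : ℝ)) * ‖x‖ ^ 2 := rpow_sub_natCast_mul hr n 2
  have e := rpow_neg_two_mul_sq hr
  have e' := exp_neg_log_sq hr
  have hp := pderiv_radial (x := x) hF.exp_neg_mul (by norm_num)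
  rw [hK'] at hp
  have hgrad (i j : Fin n) :
      pderiv i (fun x => x j * (Real.exp (-Real.log ‖x‖) * F (Real.log ‖x‖))) x ^ 2 =
      Real.exp (-Real.log ‖x‖) ^ 2 * (x j ^ 2 * (x i ^ 2 * (‖x‖ ^ (-2 : ℝ) *
        (deriv F (Real.log ‖x‖) - F (Real.log ‖x‖))) ^ 2) + if j = i then
        2 * x i ^ 2 * (‖x‖ ^ (-2 : ℝ) * (deriv F (Real.log ‖x‖) - F (Real.log ‖x‖))) *
          F (Real.log ‖x‖) + F (Real.log ‖x‖) ^ 2 else 0) := by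
    rw [pderiv_coord_mul (hT.contDiff.differentiable (by norm_num) x), hp]
    split_ifs with h
    · subst h
      ring
    · ring
  simp only [norm_gradient_sq, hgrad, e2]
  simp only [← Finset.mul_sum, Finset.sum_add_distrib, ← Finset.sum_mul, sum_coord_sq,
    Finset.sum_ite_eq, Finset.mem_univ, if_true, Finset.sum_const, Finset.card_univ,
    Fintype.card_fin, nsmul_eq_mul]
  generalize deriv F (Real.log ‖x‖) = A
  generalize F (Real.log ‖x‖) = B
  generalize ‖x‖ ^ (-2 : ℝ) = p at *
  generalize Real.exp (-Real.log ‖x‖) = y at *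
  linear_combination ‖x‖ ^ (-(n : ℝ)) *
    (((A - B) ^ 2 * (p * ‖x‖ ^ 2 + 1) + 2 * (A - B) * B) * y ^ 2 * ‖x‖ ^ 2 * e +
      (A ^ 2 + (n - 1) * B ^ 2) * e')

end RadialIntegrals

section Minimizing

variable {n : ℕ}

theorem hasCompactSupport_sq {p : ℝ → ℝ} (hpc : HasCompactSupport p) :
    HasCompactSupport fun t => p t ^ 2 :=
  hpc.comp_left (g := fun y => y ^ 2) (by norm_num)

theorem integrable_sq_of_hasCompactSupport {p : ℝ → ℝ} (hp : Continuous p)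
    (hpc : HasCompactSupport p) : Integrable fun t => p t ^ 2 :=
  (hp.pow 2).integrable_of_hasCompactSupport (hasCompactSupport_sq hpc)

theorem exists_pos_integral_sq_lt {f g h : ℝ → ℝ} (hf : Continuous f) (hfc : HasCompactSupport f)
    (hg : Continuous g) (hgc : HasCompactSupport g) (hh : Continuous h)
    (hhc : HasCompactSupport h) {b : ℝ} (hb : ∫ t, h t ^ 2 < b) :
    ∃ s > 0, ∫ t, (s ^ 2 * f t + s * g t + h t) ^ 2 < b := by
  have hh2 := integrable_sq_of_hasCompactSupport hh hhc
  have hM : Integrable fun t => 3 * f t ^ 2 + 3 * g t ^ 2 + 2 * h t ^ 2 :=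
    (((integrable_sq_of_hasCompactSupport hf hfc).const_mul 3).add
      ((integrable_sq_of_hasCompactSupport hg hgc).const_mul 3)).add (hh2.const_mul 2)
  set M : ℝ := ∫ t, (3 * f t ^ 2 + 3 * g t ^ 2 + 2 * h t ^ 2) with hMdef
  have hM0 : 0 ≤ M := integral_nonneg fun t => by positivity
  set δ := b - ∫ t, h t ^ 2 with hδ
  have hδ0 : 0 < δ := sub_pos.2 hb
  have hpos : 0 < δ + M + 1 := by positivity
  set s := δ / (δ + M + 1) with hs
  have hs0 : 0 < s := by positivity
  have hs1 : s ≤ 1 := (div_le_one hpos).2 (by linarith)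
  have hsM : s * M < δ := by
    rw [hs, div_mul_eq_mul_div, div_lt_iff₀ hpos]
    nlinarith
  refine ⟨s, hs0, ?_⟩
  calc ∫ t, (s ^ 2 * f t + s * g t + h t) ^ 2
      ≤ ∫ t, (h t ^ 2 + s * (3 * f t ^ 2 + 3 * g t ^ 2 + 2 * h t ^ 2)) := by
        refine integral_mono_of_nonneg (.of_forall fun t => sq_nonneg _)
          (hh2.add (hM.const_mul s)) (.of_forall fun t => ?_)
        have h1 : 0 ≤ s * (h t - s * f t) ^ 2 := by positivity
        have h2 : 0 ≤ s * (h t - g t) ^ 2 := by positivity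
        have h3 : 0 ≤ s ^ 2 * (s * f t - g t) ^ 2 := by positivity
        have h4 : s ^ 2 ≤ s := by nlinarith
        have h5 : s ^ 2 * s ≤ s := by nlinarith
        have h6 : s ^ 2 * s ^ 2 ≤ s := by nlinarith
        have h7 := mul_le_mul_of_nonneg_right h4 (sq_nonneg (g t))
        have h8 := mul_le_mul_of_nonneg_right h5 (sq_nonneg (f t))
        have h9 := mul_le_mul_of_nonneg_right h6 (sq_nonneg (f t))
        simp only
        linarith
    _ = (∫ t, h t ^ 2) + s * M := by
        rw [integral_add hh2 (hM.const_mul s), integral_const_mul]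
    _ < b := by linarith

theorem exists_isProfile : ∃ φ : ℝ → ℝ, IsProfile 2 φ ∧ 0 < (∫ t, φ t ^ 2) ∧
    0 < ∫ t, deriv φ t ^ 2 := by
  let φ : ContDiffBump (2 : ℝ) := ⟨1 / 4, 1 / 2, by norm_num, by norm_num⟩
  have hφ : IsProfile 2 φ := by
    refine ⟨φ.contDiff, φ.hasCompactSupport, fun t ht => ?_⟩
    rw [φ.tsupport_eq, Metric.mem_closedBall, Real.dist_eq, abs_le] at ht
    have : -(1 / 2) ≤ t - 2 := ht.1
    exact Set.mem_Ioi.2 (by linarith)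
  have hφ' : IsProfile 1 (deriv φ) := hφ.deriv (by norm_num [one_add_one_eq_two])
  have h1 : φ 2 = 1 := φ.one_of_mem_closedBall (by simp [φ.rIn_pos.le])
  have pos {p : ℝ → ℝ} (hp : Continuous p) (hpc : HasCompactSupport p) {t : ℝ} (ht : p t ≠ 0) :
      0 < ∫ t, p t ^ 2 :=
    (hp.pow 2).integral_pos_of_hasCompactSupport_nonneg_nonzero (hasCompactSupport_sq hpc)
      (fun t => sq_nonneg _) (pow_ne_zero 2 ht)
  refine ⟨φ, hφ, pos φ.continuous φ.hasCompactSupport (t := 2) (by simp [h1]), ?_⟩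
  obtain ⟨t, ht⟩ : ∃ t, deriv φ t ≠ 0 := by
    by_contra! h
    have := is_const_of_deriv_eq_zero (hφ.contDiff.differentiable (by norm_num)) h 2 0
    rw [h1, hφ.eq_zero le_rfl] at this
    norm_num at this
  exact pos hφ'.contDiff.continuous hφ'.compact ht

theorem deriv_comp_const_mul (φ : ℝ → ℝ) (s : ℝ) :
    deriv (fun t => φ (s * t)) = fun t => s * deriv φ (s * t) :=
  funext fun t => by rw [deriv_comp_mul_left, smul_eq_mul]

theorem deriv_deriv_comp_const_mul (φ : ℝ → ℝ) (s : ℝ) :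
    deriv (deriv fun t => φ (s * t)) = fun t => s ^ 2 * deriv (deriv φ) (s * t) := by
  rw [deriv_comp_const_mul]
  funext t
  rw [deriv_const_mul_field, deriv_comp_const_mul]
  ring

theorem integral_comp_const_mul (G : ℝ → ℝ) {s : ℝ} (hs : 0 < s) :
    ∫ t, G (s * t) = s⁻¹ * ∫ t, G t := by
  rw [Measure.integral_comp_mul_left, abs_of_pos (inv_pos.2 hs), smul_eq_mul]

theorem mul_volume_ball_pos [NeZero n] :
    0 < n * volume.real (Metric.ball (0 : EuclideanSpace ℝ (Fin n)) 1) :=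
  mul_pos (Nat.cast_pos.2 (Nat.pos_of_ne_zero (NeZero.ne n)))
    (ENNReal.toReal_pos (Metric.measure_ball_pos _ _ one_pos).ne' measure_ball_lt_top.ne)

theorem exists_radial_lt [NeZero n] {C : ℝ} (hC : ((n : ℝ) - 2) ^ 2 < C) :
    ∃ u : EuclideanSpace ℝ (Fin n) → ℝ, IsTest 2 u ∧
      ∫ x, ‖x‖ ^ (4 - (n : ℝ)) * lap u x ^ 2 <
        C * ∫ x, ‖x‖ ^ (2 - (n : ℝ)) * ‖gradient u x‖ ^ 2 := by
  obtain ⟨φ, hφ, -, hpos⟩ := exists_isProfile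
  have hφ' : IsProfile 1 (deriv φ) := hφ.deriv (by norm_num [one_add_one_eq_two])
  have hφ'' : IsProfile 0 (deriv (deriv φ)) := hφ'.deriv (by norm_num)
  obtain ⟨s, hs, hlt⟩ := exists_pos_integral_sq_lt (f := fun _ => (0 : ℝ)) continuous_const
    HasCompactSupport.zero
    hφ''.contDiff.continuous hφ''.compact (h := fun t => ((n : ℝ) - 2) * deriv φ t)
    (hφ'.contDiff.continuous.const_mul _) hφ'.compact.mul_left
    (b := C * ∫ t, deriv φ t ^ 2) (by
      simp only [mul_pow, integral_const_mul]
      exact mul_lt_mul_of_pos_right hC hpos)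
  have hK := hφ.comp_mul_left hs
  refine ⟨_, hK.isTest, ?_⟩
  rw [integral_lap_radial hK, integral_gradient_radial (hK.of_le (by norm_num)),
    deriv_deriv_comp_const_mul, deriv_comp_const_mul, mul_left_comm C]
  refine mul_lt_mul_of_pos_left ?_ mul_volume_ball_pos
  have e (t : ℝ) : (s ^ 2 * deriv (deriv φ) (s * t) + (n - 2) * (s * deriv φ (s * t))) ^ 2 =
      s ^ 2 * (s ^ 2 * 0 + s * deriv (deriv φ) (s * t) + (n - 2) * deriv φ (s * t)) ^ 2 := by
    ring
  simp only [e, mul_pow s, integral_const_mul]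
  rw [integral_comp_const_mul (fun t => (s ^ 2 * 0 + s * deriv (deriv φ) t +
    (n - 2) * deriv φ t) ^ 2) hs, integral_comp_const_mul (fun t => deriv φ t ^ 2) hs]
  have := mul_lt_mul_of_pos_left hlt (show 0 < s ^ 2 * s⁻¹ by positivity)
  linarith

theorem exists_coord_mul_radial_lt [NeZero n] (hn : 2 ≤ n) {C : ℝ} (hC : (n : ℝ) - 1 < C) :
    ∃ u : EuclideanSpace ℝ (Fin n) → ℝ, IsTest 2 u ∧
      ∫ x, ‖x‖ ^ (4 - (n : ℝ)) * lap u x ^ 2 <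
        C * ∫ x, ‖x‖ ^ (2 - (n : ℝ)) * ‖gradient u x‖ ^ 2 := by
  have hn' : (2 : ℝ) ≤ n := by exact_mod_cast hn
  obtain ⟨φ, hφ, hpos, -⟩ := exists_isProfile
  have hφ' : IsProfile 1 (deriv φ) := hφ.deriv (by norm_num [one_add_one_eq_two])
  have hφ'' : IsProfile 0 (deriv (deriv φ)) := hφ'.deriv (by norm_num)
  obtain ⟨s, hs, hlt⟩ := exists_pos_integral_sq_lt hφ''.contDiff.continuous hφ''.compact
    (g := fun t => ((n : ℝ) - 2) * deriv φ t) (hφ'.contDiff.continuous.const_mul _)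
    hφ'.compact.mul_left (h := fun t => -((n : ℝ) - 1) * φ t)
    (hφ.contDiff.continuous.const_mul _) hφ.compact.mul_left
    (b := C * ((n - 1) * ∫ t, φ t ^ 2)) (by
      simp only [mul_pow, integral_const_mul]
      have := mul_lt_mul_of_pos_right hC (mul_pos (show (0 : ℝ) < n - 1 by linarith) hpos)
      linarith)
  have hF := hφ.comp_mul_left hs
  have hT : IsTest 2 fun x : EuclideanSpace ℝ (Fin n) =>
    Real.exp (-Real.log ‖x‖) * φ (s * Real.log ‖x‖) := hF.exp_neg_mul.isTest
  have hsum : ∑ j, ∫ x : EuclideanSpace ℝ (Fin n), ‖x‖ ^ (4 - (n : ℝ)) *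
        lap (fun x => x j * (Real.exp (-Real.log ‖x‖) * φ (s * Real.log ‖x‖))) x ^ 2 <
      ∑ j, C * ∫ x : EuclideanSpace ℝ (Fin n), ‖x‖ ^ (2 - (n : ℝ)) *
        ‖gradient (fun x => x j * (Real.exp (-Real.log ‖x‖) * φ (s * Real.log ‖x‖))) x‖ ^ 2 := by
    rw [← Finset.mul_sum, sum_integral_lap_coord_mul_radial hF,
      sum_integral_gradient_coord_mul_radial hF, deriv_deriv_comp_const_mul, deriv_comp_const_mul,
      mul_left_comm C]
    refine mul_lt_mul_of_pos_left ?_ mul_volume_ball_pos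
    rw [integral_comp_const_mul (fun t => (s ^ 2 * deriv (deriv φ) t + (n - 2) * (s * deriv φ t) -
      (n - 1) * φ t) ^ 2) hs, integral_comp_const_mul (fun t => (s * deriv φ t) ^ 2 +
      (n - 1) * φ t ^ 2) hs, mul_left_comm C]
    refine mul_lt_mul_of_pos_left ?_ (inv_pos.2 hs)
    have e (t : ℝ) : s ^ 2 * deriv (deriv φ) t + (n - 2) * (s * deriv φ t) - (n - 1) * φ t =
        s ^ 2 * deriv (deriv φ) t + s * ((n - 2) * deriv φ t) + -(n - 1) * φ t := by
      ring
    simp only [e]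
    refine hlt.trans_le (mul_le_mul_of_nonneg_left ?_ (by linarith))
    have i0 := integrable_sq_of_hasCompactSupport hφ.contDiff.continuous hφ.compact
    have i1 : Integrable fun t => (s * deriv φ t) ^ 2 :=
      integrable_sq_of_hasCompactSupport (hφ'.contDiff.continuous.const_mul s)
        hφ'.compact.mul_left
    rw [integral_add i1 (i0.const_mul _), integral_const_mul]
    exact le_add_of_nonneg_left (integral_nonneg fun t => sq_nonneg _)
  obtain ⟨j, -, hj⟩ := Finset.exists_lt_of_sum_lt hsum
  exact ⟨_, hT.coord_mul j, hj⟩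

end Minimizing

theorem statement4 (n : ℕ) (hn : 2 ≤ n) :
    sInf {r : ℝ | ∃ u : EuclideanSpace ℝ (Fin n) → ℝ,
        ContDiff ℝ 2 u ∧ HasCompactSupport u ∧
        (0 : EuclideanSpace ℝ (Fin n)) ∉ tsupport u ∧
        (∫ x : EuclideanSpace ℝ (Fin n), ‖x‖ ^ (2 - (n : ℝ)) * ‖gradient u x‖ ^ 2) ≠ 0 ∧
        r = (∫ x : EuclideanSpace ℝ (Fin n), ‖x‖ ^ (4 - (n : ℝ)) * (lap u x) ^ 2) /
            (∫ x : EuclideanSpace ℝ (Fin n), ‖x‖ ^ (2 - (n : ℝ)) * ‖gradient u x‖ ^ 2)} =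
      min (((n : ℝ) - 2) ^ 2) ((n : ℝ) - 1) := by
  have : NeZero n := ⟨by omega⟩
  have hn' : (2 : ℝ) ≤ n := by exact_mod_cast hn
  set S := {r : ℝ | ∃ u : EuclideanSpace ℝ (Fin n) → ℝ, _}
  have hnum (u : EuclideanSpace ℝ (Fin n) → ℝ) :
      0 ≤ ∫ x, ‖x‖ ^ (4 - (n : ℝ)) * lap u x ^ 2 :=
    integral_nonneg fun x => by positivity
  have hden (u : EuclideanSpace ℝ (Fin n) → ℝ) :
      0 ≤ ∫ x, ‖x‖ ^ (2 - (n : ℝ)) * ‖gradient u x‖ ^ 2 :=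
    integral_nonneg fun x => by positivity
  have hbound : ∀ r ∈ S, min (((n : ℝ) - 2) ^ 2) ((n : ℝ) - 1) ≤ r := by
    rintro r ⟨u, hu, hc, h0, hne, rfl⟩
    rw [le_div_iff₀ ((hden u).lt_of_ne' hne)]
    rcases hn.eq_or_lt with rfl | h3
    · refine le_trans (le_of_eq ?_) (hnum u)
      norm_num
    · exact rellich_lower_bound h3 ⟨hu, hc, h0⟩ (min_le_left _ _) (min_le_right _ _)
  have hmem {C : ℝ} (hC : 0 < C) (h : ∃ u : EuclideanSpace ℝ (Fin n) → ℝ, IsTest 2 u ∧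
      ∫ x, ‖x‖ ^ (4 - (n : ℝ)) * lap u x ^ 2 <
        C * ∫ x, ‖x‖ ^ (2 - (n : ℝ)) * ‖gradient u x‖ ^ 2) : ∃ r ∈ S, r < C := by
    obtain ⟨u, hu, hlt⟩ := h
    have hpos := pos_of_mul_pos_right ((hnum u).trans_lt hlt) hC.le
    exact ⟨_, ⟨u, hu.contDiff, hu.compact, hu.zero_notMem, hpos.ne', rfl⟩,
      (div_lt_iff₀ hpos).2 hlt⟩
  have hbdd : BddBelow S := ⟨_, hbound⟩
  have hle {c : ℝ} (h : ∀ C, c < C → ∃ r ∈ S, r < C) : sInf S ≤ c :=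
    le_of_forall_gt fun C hC => by
      obtain ⟨r, hr, hlt⟩ := h C hC
      exact (csInf_le hbdd hr).trans_lt hlt
  have hradial (C : ℝ) (hC : ((n : ℝ) - 2) ^ 2 < C) : ∃ r ∈ S, r < C :=
    hmem ((sq_nonneg _).trans_lt hC) (exists_radial_lt hC)
  obtain ⟨r, hr, -⟩ := hradial _ (lt_add_one _)
  exact le_antisymm (le_min (hle hradial) (hle fun C hC =>
    hmem (by linarith) (exists_coord_mul_radial_lt hn hC))) (le_csInf ⟨r, hr⟩ hbound)
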